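/- Assume τ is a regular element, i.e. V_reg^τ ≠ ∅. Then the map sending the W^τ-orbit of a pair (v, v*) ∈ V_reg^τ × (V*)^τ to its W-orbit is a bijection from the set of W^τ-orbits on V_reg^τ × (V*)^τ onto the set of τ-stable W-orbits on V_reg × V* (where W acts diagonally on V_reg × V*). -/

import Mathlib

open Module

noncomputable section

variable {V : Type*} [AddCommGroup V] [Module ℂ V] [FiniteDimensional ℂ V]

/-- `g` is a reflection: its fixed-point subspace has codimension 1. -/
def IsReflection (g : V ≃ₗ[ℂ] V) : Prop :=
  finrank ℂ (LinearMap.ker ((g : V →ₗ[ℂ] V) - LinearMap.id)) + 1 = finrank ℂ V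

/-- The set of points of `V` with trivial stabilizer in `W`. -/
def VReg (W : Subgroup (V ≃ₗ[ℂ] V)) : Set V :=
  {v | ∀ w ∈ W, w v = v → w = 1}

/-- The contragredient action of `g` on the dual space: `(g · x)(v) = x(g⁻¹ v)`. -/
def dAct (g : V ≃ₗ[ℂ] V) (x : Module.Dual ℂ V) : Module.Dual ℂ V :=
  x ∘ₗ (g.symm : V →ₗ[ℂ] V)

/-- The diagonal action of `g` on `V × V*`. -/
def pAct (g : V ≃ₗ[ℂ] V) (p : V × Module.Dual ℂ V) : V × Module.Dual ℂ V :=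
  (g p.1, dAct g p.2)

section InvariantTheory

open MvPolynomial
open scoped Pointwise

variable {σ K : Type*} [Field K]

/-- An algebra endomorphism of a polynomial ring is linear when it sends variables to
linear forms. -/
def IsLinearSubst (φ : MvPolynomial σ K →ₐ[K] MvPolynomial σ K) : Prop :=
  ∀ i, (φ (X i)).IsHomogeneous 1

lemma IsLinearSubst.map_isHomogeneous {φ : MvPolynomial σ K →ₐ[K] MvPolynomial σ K}
    (hφ : IsLinearSubst φ) {p : MvPolynomial σ K} {n : ℕ} (hp : p.IsHomogeneous n) :
    (φ p).IsHomogeneous n := by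
  have h : φ = aeval (fun i => φ (X i)) := by ext; simp
  rw [h]
  simpa using hp.aeval _ hφ

lemma IsLinearSubst.homogeneousComponent_map {φ : MvPolynomial σ K →ₐ[K] MvPolynomial σ K}
    (hφ : IsLinearSubst φ) (n : ℕ) (p : MvPolynomial σ K) :
    homogeneousComponent n (φ p) = φ (homogeneousComponent n p) := by
  conv_lhs => rw [← sum_homogeneousComponent p, map_sum, map_sum]
  rw [Finset.sum_congr rfl fun i _ => homogeneousComponent_of_mem
    (hφ.map_isHomogeneous (homogeneousComponent_isHomogeneous i p))]
  rw [Finset.sum_ite_eq]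
  split_ifs with h
  · rfl
  · rw [homogeneousComponent_eq_zero, map_zero]
    simpa using h

lemma IsLinearSubst.totalDegree_map_le {φ : MvPolynomial σ K →ₐ[K] MvPolynomial σ K}
    (hφ : IsLinearSubst φ) (p : MvPolynomial σ K) : (φ p).totalDegree ≤ p.totalDegree := by
  conv_lhs => rw [← sum_homogeneousComponent p, map_sum]
  refine totalDegree_finsetSum_le fun i hi => ?_
  have := (hφ.map_isHomogeneous (homogeneousComponent_isHomogeneous i p)).totalDegree_le
  have := Finset.mem_range.mp hi
  lia

lemma homogeneousComponent_mul_of_isHomogeneous {q : MvPolynomial σ K} {m : ℕ}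
    (hq : q.IsHomogeneous m) (n : ℕ) (p : MvPolynomial σ K) :
    homogeneousComponent n (p * q) =
      if m ≤ n then homogeneousComponent (n - m) p * q else 0 := by
  conv_lhs => rw [← sum_homogeneousComponent p, Finset.sum_mul, map_sum]
  rw [Finset.sum_congr rfl fun i _ => homogeneousComponent_of_mem
    ((homogeneousComponent_isHomogeneous i p).mul hq)]
  split_ifs with h
  · have h' (i : ℕ) : n = i + m ↔ n - m = i := by lia
    simp only [h']
    rw [Finset.sum_ite_eq]
    split_ifs with h2
    · rfl
    · rw [homogeneousComponent_eq_zero (n := n - m), zero_mul]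
      have := Finset.mem_range.not.mp h2
      lia
  · exact Finset.sum_eq_zero fun i _ => if_neg (by lia)

variable {G : Type*} [Group G]

/-- `p` is fixed by the action `ρ`. -/
def IsFixedPoly (ρ : G →* (MvPolynomial σ K →ₐ[K] MvPolynomial σ K)) (p : MvPolynomial σ K) :
    Prop :=
  ∀ g, ρ g p = p

variable {ρ : G →* (MvPolynomial σ K →ₐ[K] MvPolynomial σ K)}

lemma IsFixedPoly.homogeneousComponent {p : MvPolynomial σ K} (hρ : ∀ g, IsLinearSubst (ρ g))
    (hp : IsFixedPoly ρ p) (n : ℕ) : IsFixedPoly ρ (homogeneousComponent n p) := fun g => by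
  rw [← (hρ g).homogeneousComponent_map, hp g]

lemma map_mem_span_of_isFixedPoly {A : Set (MvPolynomial σ K)} (hA : ∀ a ∈ A, IsFixedPoly ρ a)
    (g : G) {x : MvPolynomial σ K} (hx : x ∈ Ideal.span A) : ρ g x ∈ Ideal.span A := by
  induction hx using Submodule.span_induction with
  | mem x h => rw [hA x h g]; exact Ideal.subset_span h
  | zero => simp
  | add x y _ _ hx hy => rw [map_add]; exact add_mem hx hy
  | smul a x _ hx => rw [smul_eq_mul, map_mul]; exact Ideal.mul_mem_left _ _ hx

/-- `φ` moves every polynomial by a multiple of the nonzero linear form `L`. -/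
def IsReflectionSubst (φ : MvPolynomial σ K →ₐ[K] MvPolynomial σ K) : Prop :=
  ∃ L : MvPolynomial σ K, L.IsHomogeneous 1 ∧ L ≠ 0 ∧ ∀ p, L ∣ φ p - p

/-- The hypotheses on a linear action that hold for a complex reflection group. -/
structure IsReflectionAction (ρ : G →* (MvPolynomial σ K →ₐ[K] MvPolynomial σ K)) : Prop where
  isLinearSubst : ∀ g, IsLinearSubst (ρ g)
  closure_eq_top : Subgroup.closure {g | IsReflectionSubst (ρ g)} = ⊤

lemma exists_mem_span_of_dvd {φ : MvPolynomial σ K →ₐ[K] MvPolynomial σ K} {L : MvPolynomial σ K}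
    (hL : ∀ p, L ∣ φ p - p) {A : Set (MvPolynomial σ K)} (hA : ∀ a ∈ A, φ a = a)
    {x : MvPolynomial σ K} (hx : x ∈ Ideal.span A) :
    ∃ y ∈ Ideal.span A, φ x - x = L * y := by
  rw [Ideal.span, Submodule.mem_span_set'] at hx
  obtain ⟨n, c, a, rfl⟩ := hx
  choose d hd using fun i => hL (c i)
  refine ⟨∑ i, d i * (a i : MvPolynomial σ K),
    Ideal.sum_mem _ fun i _ => Ideal.mul_mem_left _ _ (Ideal.subset_span (a i).2), ?_⟩
  rw [map_sum, ← Finset.sum_sub_distrib, Finset.mul_sum]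
  refine Finset.sum_congr rfl fun i _ => ?_
  rw [smul_eq_mul, map_mul, hA _ (a i).2, ← sub_mul, hd, mul_assoc]

lemma IsReflectionAction.map_sub_self_mem (hρ : IsReflectionAction ρ) {B : Set (MvPolynomial σ K)}
    (hB : ∀ b ∈ B, IsFixedPoly ρ b) {p : MvPolynomial σ K}
    (h : ∀ g, IsReflectionSubst (ρ g) → ρ g p - p ∈ Ideal.span B) (g : G) :
    ρ g p - p ∈ Ideal.span B := by
  have hg : g ∈ Subgroup.closure {g | IsReflectionSubst (ρ g)} := by simp [hρ.closure_eq_top]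
  induction hg using Subgroup.closure_induction with
  | mem x hx => exact h x hx
  | one => simp
  | mul x y _ _ hx hy =>
    have h1 := add_mem (map_mem_span_of_isFixedPoly hB x hy) hx
    simpa [map_mul] using h1
  | inv x _ hx =>
    have h1 := neg_mem (map_mem_span_of_isFixedPoly hB x⁻¹ hx)
    have h2 : ρ x⁻¹ (ρ x p) = p := by rw [← AlgHom.mul_apply, ← map_mul]; simp
    simpa [map_sub, h2] using h1

section Averaging

variable [Fintype G]

/-- Averaging over the group. -/
def reynolds (ρ : G →* (MvPolynomial σ K →ₐ[K] MvPolynomial σ K)) (p : MvPolynomial σ K) :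
    MvPolynomial σ K :=
  C (Fintype.card G : K)⁻¹ * ∑ g, ρ g p

lemma isFixedPoly_reynolds (p : MvPolynomial σ K) : IsFixedPoly ρ (reynolds ρ p) := fun g => by
  have hC (c : K) : ρ g (C c) = C c := (ρ g).commutes c
  rw [reynolds, map_mul, hC, map_sum]
  congr 1
  simpa using Fintype.sum_equiv (Equiv.mulLeft g) (fun h => ρ g (ρ h p)) (fun h => ρ h p)
    (fun h => by simp)

variable [CharZero K]

lemma C_inv_card_mul_card :
    (C (Fintype.card G : K)⁻¹ * (Fintype.card G : MvPolynomial σ K)) = 1 := by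
  have : (Fintype.card G : MvPolynomial σ K) = C (Fintype.card G : K) := by simp
  rw [this, ← C_mul, inv_mul_cancel₀ (by simp), C_1]

lemma reynolds_sub_mem {I : Ideal (MvPolynomial σ K)} {p : MvPolynomial σ K}
    (h : ∀ g, ρ g p - p ∈ I) : reynolds ρ p - p ∈ I := by
  have : reynolds ρ p - p = C (Fintype.card G : K)⁻¹ * ∑ g, (ρ g p - p) := by
    rw [reynolds, Finset.sum_sub_distrib, mul_sub, Finset.sum_const, Finset.card_univ,
      nsmul_eq_mul, ← mul_assoc, C_inv_card_mul_card, one_mul]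
  rw [this]
  exact I.mul_mem_left _ (I.sum_mem fun g _ => h g)

lemma IsFixedPoly.reynolds_eq {p : MvPolynomial σ K} (hp : IsFixedPoly ρ p) :
    reynolds ρ p = p := by
  have := reynolds_sub_mem (I := ⊥) (ρ := ρ) (p := p) (fun g => by simp [hp g])
  simpa [sub_eq_zero] using this

lemma IsFixedPoly.exists_sum_eq {κ : Type*} [Fintype κ] {f : κ → MvPolynomial σ K}
    (hf : ∀ k, IsFixedPoly ρ (f k)) {p : MvPolynomial σ K} (hp : IsFixedPoly ρ p)
    (hmem : p ∈ Ideal.span (Set.range f)) :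
    ∃ q : κ → MvPolynomial σ K, (∀ k, IsFixedPoly ρ (q k)) ∧ p = ∑ k, q k * f k := by
  obtain ⟨q, rfl⟩ := Ideal.mem_span_range_iff_exists_fun.mp hmem
  refine ⟨fun k => reynolds ρ (q k), fun k => isFixedPoly_reynolds _, ?_⟩
  conv_lhs => rw [← hp.reynolds_eq, reynolds]
  simp only [map_sum, map_mul, hf _ _, reynolds, mul_assoc, Finset.sum_mul, ← Finset.mul_sum]
  rw [Finset.sum_comm]

/-- The key lemma in Chevalley's proof. -/
theorem IsReflectionAction.mem_of_mul_mem (hρ : IsReflectionAction ρ)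
    {A B : Set (MvPolynomial σ K)} (hA : ∀ a ∈ A, IsFixedPoly ρ a)
    (hB : ∀ b ∈ B, IsFixedPoly ρ b)
    (hpos : ∀ p n, n ≠ 0 → p.IsHomogeneous n → IsFixedPoly ρ p → p ∈ Ideal.span B)
    {u : MvPolynomial σ K} (hu : IsFixedPoly ρ u) (huA : u ∉ Ideal.span A)
    (hBu : ∀ b ∈ Ideal.span B, b * u ∈ Ideal.span A) (P : MvPolynomial σ K)
    (hP : P * u ∈ Ideal.span A) : P ∈ Ideal.span B := by
  induction hd : P.totalDegree using Nat.strong_induction_on generalizing P with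
  | _ d ih =>
    have h1 : ∀ g, IsReflectionSubst (ρ g) → ρ g P - P ∈ Ideal.span B := by
      rintro g ⟨L, hL1, hL0, hL⟩
      obtain ⟨y, hy, hLy⟩ := exists_mem_span_of_dvd hL (fun a ha => hA a ha g) hP
      obtain ⟨Q, hQ⟩ := hL P
      rw [map_mul, hu g, ← sub_mul, hQ, mul_assoc] at hLy
      have hQu : Q * u ∈ Ideal.span A := by rwa [mul_left_cancel₀ hL0 hLy]
      rw [hQ]
      by_cases hQ0 : Q = 0
      · simp [hQ0]
      refine Ideal.mul_mem_left _ _ (ih Q.totalDegree ?_ Q hQu rfl)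
      have h2 : (L * Q).totalDegree = 1 + Q.totalDegree := by
        rw [totalDegree_mul_of_isDomain hL0 hQ0, hL1.totalDegree hL0]
      have h3 : (L * Q).totalDegree ≤ P.totalDegree := by
        rw [← hQ]
        exact (totalDegree_sub _ _).trans
          (max_le ((hρ.isLinearSubst g).totalDegree_map_le P) le_rfl)
      lia
    have h2 := reynolds_sub_mem (hρ.map_sub_self_mem hB h1)
    have h3 : reynolds ρ P - C (coeff 0 (reynolds ρ P)) ∈ Ideal.span B := by
      nth_rw 1 [← sum_homogeneousComponent (reynolds ρ P)]
      rw [Finset.sum_range_succ', homogeneousComponent_zero, add_sub_cancel_right]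
      exact Ideal.sum_mem _ fun i _ => hpos _ (i + 1) (by simp)
        (homogeneousComponent_isHomogeneous _ _)
        ((isFixedPoly_reynolds P).homogeneousComponent hρ.isLinearSubst _)
    set c := coeff 0 (reynolds ρ P)
    have h4 : P - C c ∈ Ideal.span B := by
      have := Ideal.sub_mem _ h3 h2
      rwa [sub_sub_sub_cancel_left, ] at this
    have h5 : C c * u ∈ Ideal.span A := by
      have := Ideal.sub_mem _ hP (hBu _ h4)
      rwa [← sub_mul, sub_sub_cancel] at this
    have hc : c = 0 := by
      by_contra hc
      apply huA
      have := Ideal.mul_mem_left _ (C c⁻¹) h5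
      rwa [← mul_assoc, ← C_mul, inv_mul_cancel₀ hc, C_1, one_mul] at this
    simpa [hc] using h4

end Averaging

/-- A minimal family of homogeneous generators of the ideal generated by the homogeneous
invariants of positive degree. -/
structure IsMinimalFundamental (ρ : G →* (MvPolynomial σ K →ₐ[K] MvPolynomial σ K))
    {κ : Type*} (f : κ → MvPolynomial σ K) (d : κ → ℕ) : Prop where
  isFixedPoly : ∀ k, IsFixedPoly ρ (f k)
  isHomogeneous : ∀ k, (f k).IsHomogeneous (d k)
  degree_ne_zero : ∀ k, d k ≠ 0
  mem_span : ∀ p n, n ≠ 0 → p.IsHomogeneous n → IsFixedPoly ρ p → p ∈ Ideal.span (Set.range f)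
  notMem_span : ∀ j, f j ∉ Ideal.span (f '' {j}ᶜ)

namespace IsMinimalFundamental

variable {κ : Type*} {f : κ → MvPolynomial σ K} {d : κ → ℕ}

lemma isFixedPoly_aeval (hf : IsMinimalFundamental ρ f d) (Q : MvPolynomial κ K) :
    IsFixedPoly ρ (aeval f Q) := fun g => by
  rw [← AlgHom.comp_apply]
  congr 1
  ext k
  simp [hf.isFixedPoly k g]

attribute [local instance] MvPolynomial.gradedAlgebra in
lemma coeff_zero_eq_zero [Fintype κ] (hf : IsMinimalFundamental ρ f d)
    {e : κ → MvPolynomial σ K} (he : ∑ k, e k * f k = 0) (j : κ) : coeff 0 (e j) = 0 := by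
  classical
  have h1 : e j * f j ∈ Ideal.span (f '' {j}ᶜ) := by
    rw [← Finset.add_sum_erase _ _ (Finset.mem_univ j), add_eq_zero_iff_eq_neg] at he
    rw [he]
    refine neg_mem (Ideal.sum_mem _ fun k hk => Ideal.mul_mem_left _ _ (Ideal.subset_span ?_))
    exact ⟨k, by simpa using hk, rfl⟩
  have h2 : (Ideal.span (f '' {j}ᶜ)).IsHomogeneous (homogeneousSubmodule σ K) := by
    apply Ideal.homogeneous_span
    rintro _ ⟨k, -, rfl⟩
    exact ⟨d k, hf.isHomogeneous k⟩
  have h3 := homogeneousComponent_mem_of_mem h2 h1 (d j)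
  rw [homogeneousComponent_mul_of_isHomogeneous (hf.isHomogeneous j), if_pos le_rfl, tsub_self,
    homogeneousComponent_zero] at h3
  by_contra hc
  apply hf.notMem_span j
  have := Ideal.mul_mem_left _ (C (coeff 0 (e j))⁻¹) h3
  rwa [← mul_assoc, ← C_mul, inv_mul_cancel₀ hc, C_1, one_mul] at this

lemma coeff_zero_eq_zero_of_mem (hf : IsMinimalFundamental ρ f d) {p : MvPolynomial σ K}
    (hp : p ∈ Ideal.span (Set.range f)) : coeff 0 p = 0 := by
  have : Ideal.span (Set.range f) ≤ RingHom.ker (constantCoeff (R := K) (σ := σ)) := by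
    rw [Ideal.span_le]
    rintro _ ⟨k, rfl⟩
    exact (hf.isHomogeneous k).coeff_eq_zero (by simpa using (hf.degree_ne_zero k).symm)
  exact this hp

/-- A fixed polynomial is a polynomial in the fundamental invariants. -/
lemma mem_range_aeval [Fintype G] [CharZero K] [Fintype κ] (hρ : ∀ g, IsLinearSubst (ρ g))
    (hf : IsMinimalFundamental ρ f d) {p : MvPolynomial σ K} (hp : IsFixedPoly ρ p) :
    p ∈ (aeval (R := K) f).range := by
  suffices h : ∀ n, ∀ p : MvPolynomial σ K, IsFixedPoly ρ p → p.IsHomogeneous n →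
      p ∈ (aeval (R := K) f).range by
    rw [← sum_homogeneousComponent p]
    exact sum_mem fun n _ => h n _ (hp.homogeneousComponent hρ n)
      (homogeneousComponent_isHomogeneous n p)
  intro n
  induction n using Nat.strong_induction_on with
  | _ n ih =>
    intro p hp hn
    by_cases hn0 : n = 0
    · subst hn0
      rw [← homogeneousComponent_eq_self hn, homogeneousComponent_zero]
      exact (aeval (R := K) f).range.algebraMap_mem _
    obtain ⟨q, hq, hpq⟩ := hp.exists_sum_eq hf.isFixedPoly (hf.mem_span p n hn0 hn hp)
    rw [← homogeneousComponent_eq_self hn, hpq, map_sum]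
    refine sum_mem fun k _ => ?_
    rw [homogeneousComponent_mul_of_isHomogeneous (hf.isHomogeneous k)]
    split_ifs with hk
    · have hd := hf.degree_ne_zero k
      exact mul_mem (ih _ (by lia) _ ((hq k).homogeneousComponent hρ _)
        (homogeneousComponent_isHomogeneous _ _)) ⟨X k, by simp⟩
    · exact zero_mem _

end IsMinimalFundamental

lemma pderiv_aeval_eq_sum {κ : Type*} [Fintype κ] (f : κ → MvPolynomial σ K) (i : σ)
    (H : MvPolynomial κ K) :
    pderiv i (aeval f H) = ∑ k, aeval f (pderiv k H) * pderiv i (f k) := by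
  classical
  induction H using MvPolynomial.induction_on with
  | C a => simp
  | add p q hp hq => simp only [map_add, hp, hq, add_mul, Finset.sum_add_distrib]
  | mul_X p j h =>
    simp only [map_mul, aeval_X, Derivation.leibniz, h, smul_eq_mul, pderiv_X, map_add, add_mul,
      Finset.sum_add_distrib, Finset.mul_sum]
    congr 1
    · rw [Finset.sum_eq_single j (fun k _ hk => by simp [hk.symm]) (by simp)]
      simp
    · exact Finset.sum_congr rfl fun k _ => by ring

lemma totalDegree_pderiv_lt {κ : Type*} {H : MvPolynomial κ K} {k : κ} (h : pderiv k H ≠ 0) :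
    (pderiv k H).totalDegree < H.totalDegree := by
  have key : ∀ m ∈ (pderiv k H).support, m.degree < H.totalDegree := fun m hm => by
    rw [MvPolynomial.mem_support_iff, coeff_pderiv] at hm
    have := le_totalDegree (MvPolynomial.mem_support_iff.mpr (left_ne_zero_of_mul hm))
    have h2 : (m + Finsupp.single k 1).degree = m.degree + 1 := by simp
    change (m + Finsupp.single k 1).degree ≤ _ at this
    lia
  obtain ⟨m, hm⟩ := support_nonempty.mpr h
  exact (Finset.sup_lt_iff (by simpa using (Nat.zero_le _).trans_lt (key m hm))).mpr key

lemma eq_C_of_pderiv_eq_zero [CharZero K] {κ : Type*} {H : MvPolynomial κ K}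
    (h : ∀ k, pderiv k H = 0) : H = C (coeff 0 H) := by
  classical
  ext m
  rw [coeff_C]
  split_ifs with hm
  · rw [hm]
  · obtain ⟨k, hk⟩ := Finsupp.ne_iff.mp (Ne.symm hm)
    have h1 := coeff_pderiv (i := k) H (m - Finsupp.single k 1)
    rw [h k, Finsupp.sub_add_single_one_cancel hk, coeff_zero] at h1
    exact (mul_eq_zero.mp h1.symm).resolve_right (Nat.cast_add_one_ne_zero _)

namespace IsMinimalFundamental

variable {κ : Type*} {f : κ → MvPolynomial σ K} {d : κ → ℕ}

/-- A nonzero finite family is not contained in the ideal generated by its products with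
the fundamental invariants. -/
lemma exists_notMem_span_mul [Fintype κ] (hf : IsMinimalFundamental ρ f d)
    {h : κ → MvPolynomial σ K} {k : κ} (hk : h k ≠ 0) :
    ∃ l, h l ∉ Ideal.span (Set.range f * Set.range h) := by
  by_contra! hall
  obtain ⟨r, hr, hr0⟩ := Submodule.exists_sub_one_mem_and_smul_eq_zero_of_fg_of_le_smul
    (Ideal.span (Set.range f)) (Ideal.span (Set.range h)) ⟨(Set.finite_range h).toFinset, by simp⟩
    (by
      rw [smul_eq_mul, Ideal.span_mul_span', Ideal.span_le]
      rintro _ ⟨l, rfl⟩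
      exact hall l)
  have h1 : r = 0 := (mul_eq_zero.mp (hr0 (h k) (Ideal.subset_span ⟨k, rfl⟩))).resolve_right hk
  have h2 := hf.coeff_zero_eq_zero_of_mem hr
  simp [h1] at h2

/-- Chevalley's theorem: the fundamental invariants are algebraically independent. -/
theorem aeval_injective [Fintype G] [CharZero K] [Fintype σ] [Fintype κ]
    (hρ : IsReflectionAction ρ) (hf : IsMinimalFundamental ρ f d) :
    Function.Injective (aeval (R := K) f) := by
  classical
  rw [injective_iff_map_eq_zero]
  intro H hH
  induction hD : H.totalDegree using Nat.strong_induction_on generalizing H with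
  | _ D ih =>
    by_cases h0 : ∀ k, pderiv k H = 0
    · rw [eq_C_of_pderiv_eq_zero h0] at hH ⊢
      simpa using hH
    exfalso
    push Not at h0
    obtain ⟨k₀, hk₀⟩ := h0
    set h : κ → MvPolynomial σ K := fun k => aeval f (pderiv k H) with hdef
    have hh0 : h k₀ ≠ 0 := fun h1 => hk₀ (ih _ (hD ▸ totalDegree_pderiv_lt hk₀) _ h1 rfl)
    have hfix := hf.isFixedPoly_aeval
    let A : Finset κ → Set (MvPolynomial σ K) := fun B => h '' B ∪ Set.range f * Set.range h
    have hA (B) : ∀ a ∈ A B, IsFixedPoly ρ a := by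
      rintro a (⟨k, -, rfl⟩ | ⟨_, ⟨k, rfl⟩, _, ⟨l, rfl⟩, rfl⟩)
      · exact hfix _
      · intro g
        simp only [map_mul, hf.isFixedPoly k g, hdef, hfix _ g]
    obtain ⟨B, hB, hBmax⟩ := (Set.toFinite {B | ∃ l, h l ∉ Ideal.span (A B)}).exists_maximal
      ⟨∅, by simpa [A] using hf.exists_notMem_span_mul hh0⟩
    obtain ⟨j, hj⟩ := hB
    have hmod (k : κ) : ∃ g, h k - g * h j ∈ Ideal.span (A B) ∧ (k = j → g = 1) := by
      by_cases hkj : k = j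
      · exact ⟨1, by simp [hkj], fun _ => rfl⟩
      have hjB : j ∉ B := fun hjB => hj (Ideal.subset_span (Or.inl ⟨j, hjB, rfl⟩))
      have h1 : h k ∈ Ideal.span (A (insert j B)) := by
        by_contra hc
        exact hjB (hBmax ⟨k, hc⟩ (Finset.subset_insert j B) (Finset.mem_insert_self j B))
      have h2 : A (insert j B) = insert (h j) (A B) := by
        simp only [A, Finset.coe_insert, Set.image_insert_eq, Set.insert_union]
      rw [h2, Ideal.mem_span_insert'] at h1
      obtain ⟨a, ha⟩ := h1
      exact ⟨-a, by simpa using ha, fun h => absurd h hkj⟩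
    choose g hg hgj using hmod
    have hP (i : σ) : ∑ k, g k * pderiv i (f k) ∈ Ideal.span (Set.range f) := by
      refine hρ.mem_of_mul_mem (hA B) (u := h j) ?_ hf.mem_span (hfix _) hj ?_ _ ?_
      · rintro _ ⟨k, rfl⟩
        exact hf.isFixedPoly k
      · intro b hb
        have := Ideal.mul_mem_mul hb (Ideal.subset_span (Set.mem_range_self (f := h) j))
        rw [Ideal.span_mul_span'] at this
        exact Ideal.span_mono Set.subset_union_right this
      · have h1 : ∑ k, h k * pderiv i (f k) = 0 := by
          rw [← pderiv_aeval_eq_sum, hH, map_zero]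
        have h2 : (∑ k, g k * pderiv i (f k)) * h j =
            -∑ k, pderiv i (f k) * (h k - g k * h j) := by
          rw [eq_neg_iff_add_eq_zero, ← h1, Finset.sum_mul, ← Finset.sum_add_distrib]
          exact Finset.sum_congr rfl fun k _ => by ring
        rw [h2]
        exact neg_mem (Ideal.sum_mem _ fun k _ => Ideal.mul_mem_left _ _ (hg k))
    choose a ha using fun i => Ideal.mem_span_range_iff_exists_fun.mp (hP i)
    have hsum : ∑ k, (d k • g k - ∑ i, X i * a i k) * f k = 0 := by
      simp only [sub_mul, Finset.sum_sub_distrib, Finset.sum_mul]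
      rw [Finset.sum_comm, sub_eq_zero]
      simp only [mul_assoc, ← Finset.mul_sum, ha]
      simp only [Finset.mul_sum]
      rw [Finset.sum_comm]
      refine Finset.sum_congr rfl fun k _ => ?_
      rw [smul_mul_assoc, ← mul_smul_comm, ← (hf.isHomogeneous k).sum_X_mul_pderiv,
        Finset.mul_sum]
      exact Finset.sum_congr rfl fun i _ => by ring
    have hcoeff := hf.coeff_zero_eq_zero hsum j
    rw [← constantCoeff_eq] at hcoeff
    simp [hgj j rfl, hf.degree_ne_zero j] at hcoeff

end IsMinimalFundamental

lemma mem_span_eigenvectors {M : Type*} [AddCommGroup M] [Module K M] [CharZero K] {N : ℕ}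
    {ζ : K} (hζ : IsPrimitiveRoot ζ N) (hN : N ≠ 0) {T : Module.End K M} (hT : T ^ N = 1)
    {P : Submodule K M} (hP : ∀ x ∈ P, T x ∈ P) {x : M} (hx : x ∈ P) :
    x ∈ Submodule.span K {y | y ∈ P ∧ ∃ c : K, T y = c • y} := by
  have hζ0 : ζ ≠ 0 := hζ.ne_zero hN
  let y : ℕ → M := fun j => ∑ k ∈ Finset.range N, ((ζ ^ j)⁻¹) ^ k • (T ^ k) x
  have hTk (k : ℕ) : (T ^ k) x ∈ P := by
    induction k with
    | zero => simpa
    | succ k ih => rw [pow_succ', Module.End.mul_apply]; exact hP _ ih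
  have hyP (j : ℕ) : y j ∈ P := sum_mem fun k _ => P.smul_mem _ (hTk k)
  have hyT (j : ℕ) : T (y j) = ζ ^ j • y j := by
    have hj : ζ ^ j ≠ 0 := pow_ne_zero _ hζ0
    have h1 : T (y j) =
        ∑ k ∈ Finset.range N, ζ ^ j • ((ζ ^ j)⁻¹ ^ (k + 1) • (T ^ (k + 1)) x) := by
      simp only [y, map_sum, map_smul]
      refine Finset.sum_congr rfl fun k _ => ?_
      rw [smul_smul, pow_succ' (ζ ^ j)⁻¹, mul_inv_cancel_left₀ hj, pow_succ' T,
        Module.End.mul_apply]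
    have h2 : (ζ ^ j)⁻¹ ^ N = 1 := by
      rw [inv_pow, ← pow_mul, mul_comm, pow_mul, hζ.pow_eq_one, one_pow, inv_one]
    rw [h1, ← Finset.smul_sum]
    have h3 := (Finset.sum_range_succ (fun k => (ζ ^ j)⁻¹ ^ k • (T ^ k) x) N).symm.trans
      (Finset.sum_range_succ' (fun k => (ζ ^ j)⁻¹ ^ k • (T ^ k) x) N)
    rw [h2, hT] at h3
    simp only [pow_zero] at h3
    rw [add_right_cancel h3.symm]
  have hsum : ∑ j ∈ Finset.range N, y j = (N : K) • x := by
    simp only [y]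
    rw [Finset.sum_comm]
    simp only [← Finset.sum_smul]
    rw [Finset.sum_eq_single 0]
    · simp
    · intro k hk hk0
      have hk1 : (ζ ^ k)⁻¹ ≠ 1 := by
        rw [Ne, inv_eq_one]
        exact hζ.pow_ne_one_of_pos_of_lt hk0 (Finset.mem_range.mp hk)
      have hkN : (ζ ^ k)⁻¹ ^ N = 1 := by
        rw [inv_pow, ← pow_mul, mul_comm, pow_mul, hζ.pow_eq_one, one_pow, inv_one]
      have h4 (j : ℕ) : (ζ ^ j)⁻¹ ^ k = (ζ ^ k)⁻¹ ^ j := by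
        rw [inv_pow, inv_pow, ← pow_mul, ← pow_mul, mul_comm]
      simp only [h4]
      rw [geom_sum_eq hk1, hkN, sub_self, zero_div, zero_smul]
    · intro h
      simp [hN] at h
  have hNK : (N : K) ≠ 0 := Nat.cast_ne_zero.mpr hN
  rw [← inv_smul_smul₀ hNK x, ← hsum]
  exact Submodule.smul_mem _ _ (sum_mem fun j _ => Submodule.subset_span ⟨hyP j, _, hyT j⟩)

/-- Fundamental invariants can be chosen to be eigenvectors of a linear substitution of finite
order that preserves the invariants. -/
theorem exists_isMinimalFundamental [CharZero K] [Finite σ] {N : ℕ} {ζ : K}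
    (hζ : IsPrimitiveRoot ζ N) (hN : N ≠ 0) {θ : MvPolynomial σ K →ₐ[K] MvPolynomial σ K}
    (hθ : IsLinearSubst θ) (hθN : θ ^ N = 1) (hθρ : ∀ p, IsFixedPoly ρ p → IsFixedPoly ρ (θ p)) :
    ∃ (t : Finset (MvPolynomial σ K)) (d : t → ℕ) (ε : t → K),
      IsMinimalFundamental ρ (fun k : t => (k : MvPolynomial σ K)) d ∧
      ∀ k : t, θ k = ε k • (k : MvPolynomial σ K) := by
  classical
  let E : Set (MvPolynomial σ K) :=
    {p | IsFixedPoly ρ p ∧ (∃ n, n ≠ 0 ∧ p.IsHomogeneous n) ∧ ∃ c : K, θ p = c • p}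
  have hE (p : MvPolynomial σ K) (n : ℕ) (hn : n ≠ 0) (hp : p.IsHomogeneous n)
      (hpf : IsFixedPoly ρ p) : p ∈ Ideal.span E := by
    let P : Submodule K (MvPolynomial σ K) :=
      { carrier := {q | IsFixedPoly ρ q ∧ q.IsHomogeneous n}
        zero_mem' := ⟨fun g => map_zero _, isHomogeneous_zero _ _ _⟩
        add_mem' := fun ha hb => ⟨fun g => by rw [map_add, ha.1 g, hb.1 g], ha.2.add hb.2⟩
        smul_mem' := fun c q hq => ⟨fun g => by rw [map_smul, hq.1 g],
          (homogeneousSubmodule σ K n).smul_mem c hq.2⟩ }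
    have hT : (θ.toLinearMap : Module.End K (MvPolynomial σ K)) ^ N = 1 := by
      refine LinearMap.ext fun q => ?_
      have h1 (m : ℕ) : ((θ.toLinearMap : Module.End K (MvPolynomial σ K)) ^ m) q = (θ ^ m) q := by
        rw [Module.End.pow_apply, AlgHom.coe_pow]
        rfl
      rw [h1, hθN]
      rfl
    have h := mem_span_eigenvectors hζ hN hT (P := P)
      (fun q hq => ⟨hθρ q hq.1, hθ.map_isHomogeneous hq.2⟩) (x := p) ⟨hpf, hp⟩
    have h2 : Submodule.span K {y | y ∈ P ∧ ∃ c : K, θ.toLinearMap y = c • y} ≤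
        (Ideal.span E).restrictScalars K := by
      rw [Submodule.span_le]
      rintro y ⟨hy, hc⟩
      exact Ideal.subset_span ⟨hy.1, ⟨n, hn, hy.2⟩, hc⟩
    exact h2 h
  have hfg := (Submodule.fg_span_iff_fg_span_finset_subset E).mp
    (IsNoetherian.noetherian (Ideal.span E))
  obtain ⟨t₀, ht₀⟩ := hfg
  obtain ⟨t, -, ht⟩ := exists_minimal_le_of_wellFoundedLT
    (fun t : Finset (MvPolynomial σ K) => ↑t ⊆ E ∧ Ideal.span E = Ideal.span ↑t) t₀ ht₀
  obtain ⟨⟨htE, hspan⟩, hmin⟩ := ht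
  choose d hd using fun k : t => (htE k.2).2.1
  choose ε hε using fun k : t => (htE k.2).2.2
  refine ⟨t, d, ε, ⟨fun k => (htE k.2).1, fun k => (hd k).2, fun k => (hd k).1, ?_, ?_⟩, hε⟩
  · intro p n hn hp hpf
    rw [Subtype.range_coe_subtype]
    have := hE p n hn hp hpf
    rwa [hspan] at this
  · intro j hj
    have h1 : (fun k : t => (k : MvPolynomial σ K)) '' {j}ᶜ = ↑(t.erase j) := by
      ext q
      simp only [Set.mem_image, Set.mem_compl_iff, Set.mem_singleton_iff, Subtype.exists,
        Subtype.ext_iff, exists_and_right, exists_eq_right, Finset.mem_coe, Finset.mem_erase]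
      tauto
    rw [h1] at hj
    have h2 : Ideal.span E = Ideal.span ↑(t.erase (j : MvPolynomial σ K)) := by
      rw [hspan]
      refine le_antisymm (Ideal.span_le.mpr fun q hq => ?_)
        (Ideal.span_mono (Finset.coe_subset.mpr (Finset.erase_subset _ _)))
      by_cases hqj : q = j
      · rwa [hqj]
      · exact Ideal.subset_span (Finset.mem_erase.mpr ⟨hqj, hq⟩)
    have h3 := hmin (y := t.erase j)
      ⟨(Finset.coe_subset.mpr (Finset.erase_subset _ _)).trans htE, h2⟩ (Finset.erase_subset _ _)
    exact Finset.notMem_erase _ _ (h3 j.2)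

/-- In terms of fundamental invariants, any subset of them cuts out an irreducible subset of the
quotient. -/
theorem IsMinimalFundamental.isPrime_comap_span [Fintype G] [CharZero K] [Fintype σ]
    {κ : Type*} [Fintype κ] {f : κ → MvPolynomial σ K} {d : κ → ℕ}
    (hρ : IsReflectionAction ρ) (hf : IsMinimalFundamental ρ f d) (Z : Set κ) :
    ((Ideal.span (f '' Z)).comap (aeval (R := K) f)).IsPrime := by
  classical
  let ψ : MvPolynomial κ K →ₐ[K] MvPolynomial κ K := aeval fun k => if k ∈ Z then 0 else X k
  have hker : (Ideal.span (f '' Z)).comap (aeval (R := K) f) = RingHom.ker ψ := by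
    ext H
    rw [Ideal.mem_comap, RingHom.mem_ker]
    constructor
    · intro hH
      rw [Set.image_eq_range] at hH
      obtain ⟨q, hq, hqH⟩ := (hf.isFixedPoly_aeval H).exists_sum_eq (fun k : Z => hf.isFixedPoly k) hH
      choose Q hQ using fun k => hf.mem_range_aeval hρ.isLinearSubst (hq k)
      have h1 : H = ∑ k : Z, Q k * X (k : κ) := by
        apply hf.aeval_injective hρ
        rw [hqH, map_sum]
        refine Finset.sum_congr rfl fun k _ => ?_
        rw [map_mul, aeval_X, ← hQ k]
        rfl
      rw [h1, map_sum]
      refine Finset.sum_eq_zero fun k _ => ?_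
      simp [ψ]
    · intro hH
      have h1 : (Ideal.Quotient.mkₐ K (Ideal.span (f '' Z))).comp (aeval f) =
          (Ideal.Quotient.mkₐ K (Ideal.span (f '' Z))).comp ((aeval f).comp ψ) := by
        ext k
        by_cases hk : k ∈ Z
        · have : Ideal.Quotient.mk (Ideal.span (f '' Z)) (f k) = 0 :=
            Ideal.Quotient.eq_zero_iff_mem.mpr (Ideal.subset_span ⟨k, hk, rfl⟩)
          simp [ψ, hk, this]
        · simp [ψ, hk]
      have h2 := DFunLike.congr_fun h1 H
      simp only [AlgHom.comp_apply, hH, map_zero] at h2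
      exact Ideal.Quotient.eq_zero_iff_mem.mp h2
  rw [hker]
  exact RingHom.ker_isPrime ψ

end InvariantTheory

set_option linter.unusedSectionVars false

section Coordinates

open MvPolynomial

variable {ι : Type*} [Fintype ι] (b : Basis ι ℂ V)

/-- Evaluation at `v` of a polynomial in the coordinates with respect to `b`. -/
def evalAt (v : V) : MvPolynomial ι ℂ →ₐ[ℂ] ℂ := aeval (b.equivFun v)

/-- A linear form as a polynomial in the coordinates with respect to `b`. -/
def linForm (L : Module.Dual ℂ V) : MvPolynomial ι ℂ := ∑ j, C (L (b j)) * X j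

/-- The substitution `p ↦ p ∘ g`. -/
def linSubst (g : V →ₗ[ℂ] V) : MvPolynomial ι ℂ →ₐ[ℂ] MvPolynomial ι ℂ :=
  aeval fun i => linForm b (b.coord i ∘ₗ g)

lemma evalAt_linForm (L : Module.Dual ℂ V) (v : V) : evalAt b v (linForm b L) = L v := by
  have h := congrArg L (b.sum_equivFun v)
  rw [map_sum] at h
  rw [← h]
  simp [evalAt, linForm, mul_comm]

lemma isHomogeneous_linForm (L : Module.Dual ℂ V) : (linForm b L).IsHomogeneous 1 :=
  IsHomogeneous.sum _ _ _ fun j _ => isHomogeneous_C_mul_X _ j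

lemma evalAt_linSubst (g : V →ₗ[ℂ] V) (v : V) (p : MvPolynomial ι ℂ) :
    evalAt b v (linSubst b g p) = evalAt b (g v) p := by
  rw [← AlgHom.comp_apply]
  congr 1
  ext i
  simp only [AlgHom.comp_apply, linSubst, aeval_X, evalAt_linForm]
  simp [evalAt]

lemma evalAt_ext {p q : MvPolynomial ι ℂ} (h : ∀ v, evalAt b v p = evalAt b v q) : p = q := by
  refine MvPolynomial.funext fun x => ?_
  have := h (b.equivFun.symm x)
  rw [evalAt, b.equivFun.apply_symm_apply] at this
  exact this

lemma isLinearSubst_linSubst (g : V →ₗ[ℂ] V) : IsLinearSubst (linSubst b g) := fun i => by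
  rw [linSubst, aeval_X]
  exact isHomogeneous_linForm b _

/-- The action of a group of linear automorphisms on polynomials. -/
def polyAction (W : Subgroup (V ≃ₗ[ℂ] V)) :
    W →* (MvPolynomial ι ℂ →ₐ[ℂ] MvPolynomial ι ℂ) where
  toFun w := linSubst b ((w⁻¹ : W) : V ≃ₗ[ℂ] V)
  map_one' := by
    refine AlgHom.ext fun p => evalAt_ext b fun v => ?_
    rw [evalAt_linSubst]
    simp
  map_mul' g h := by
    refine AlgHom.ext fun p => evalAt_ext b fun v => ?_
    rw [AlgHom.mul_apply, evalAt_linSubst, evalAt_linSubst, evalAt_linSubst]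
    simp

lemma evalAt_polyAction {W : Subgroup (V ≃ₗ[ℂ] V)} (w : W) (v : V) (p : MvPolynomial ι ℂ) :
    evalAt b v (polyAction b W w p) = evalAt b ((w⁻¹ : W).1 v) p :=
  evalAt_linSubst b _ v p

lemma isFixedPoly_polyAction_iff {W : Subgroup (V ≃ₗ[ℂ] V)} {p : MvPolynomial ι ℂ} :
    IsFixedPoly (polyAction b W) p ↔ ∀ w ∈ W, ∀ v, evalAt b (w v) p = evalAt b v p := by
  constructor
  · intro h w hw v
    have := congrArg (evalAt b v) (h (⟨w, hw⟩⁻¹))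
    rwa [evalAt_polyAction, inv_inv] at this
  · intro h w
    refine evalAt_ext b fun v => ?_
    rw [evalAt_polyAction]
    exact h _ (w⁻¹).2 v

lemma isReflectionSubst_linSubst {g : V ≃ₗ[ℂ] V} (hg : IsReflection g) :
    IsReflectionSubst (linSubst b (g : V →ₗ[ℂ] V)) := by
  set D : V →ₗ[ℂ] V := (g : V →ₗ[ℂ] V) - LinearMap.id with hD
  have hr : finrank ℂ (LinearMap.range D) = 1 := by
    have h1 := D.finrank_range_add_finrank_ker
    have h2 : finrank ℂ (LinearMap.ker D) + 1 = finrank ℂ V := hg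
    lia
  obtain ⟨a, ha0, ha⟩ := finrank_eq_one_iff'.mp hr
  have ha0' : (a : V) ≠ 0 := by simpa using ha0
  obtain ⟨φ, hφ⟩ := Module.exists_dual_forall_apply_ne_zero (K := ℂ) (fun _ : Unit => (a : V))
    (fun _ => ha0')
  replace hφ : φ a ≠ 0 := hφ ()
  have hDv (v : V) : D v = (φ (D v) * (φ a)⁻¹) • (a : V) := by
    obtain ⟨c, hc⟩ := ha ⟨D v, v, rfl⟩
    have hc' : c • (a : V) = D v := congrArg Subtype.val hc
    rw [← hc', map_smul, smul_eq_mul, mul_assoc, mul_inv_cancel₀ hφ, mul_one]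
  have hev (i : ι) : linSubst b (g : V →ₗ[ℂ] V) (X i) - X i =
      linForm b (φ ∘ₗ D) * C ((φ a)⁻¹ * b.coord i a) := by
    refine evalAt_ext b fun v => ?_
    have h1 := congrArg (b.coord i) (hDv v)
    have h2 : evalAt b v (C ((φ a)⁻¹ * b.coord i a)) = (φ a)⁻¹ * b.coord i a := by simp [evalAt]
    have h3 (w : V) : evalAt b w (X i) = b.coord i w := by simp [evalAt]
    rw [map_sub, map_mul, evalAt_linSubst, evalAt_linForm, h2, h3, h3, ← map_sub]
    rw [map_smul, smul_eq_mul, mul_assoc] at h1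
    exact h1
  refine ⟨linForm b (φ ∘ₗ D), isHomogeneous_linForm b _, ?_, fun p => ?_⟩
  · intro h0
    obtain ⟨v, hv⟩ := a.2
    have := evalAt_linForm b (φ ∘ₗ D) v
    rw [h0, map_zero, LinearMap.comp_apply, hv] at this
    exact hφ this.symm
  · have h1 : (Ideal.Quotient.mkₐ ℂ (Ideal.span {linForm b (φ ∘ₗ D)})).comp
        (linSubst b (g : V →ₗ[ℂ] V)) = Ideal.Quotient.mkₐ ℂ _ := by
      refine MvPolynomial.algHom_ext fun i => ?_
      refine Ideal.Quotient.eq.mpr ?_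
      change linSubst b (g : V →ₗ[ℂ] V) (X i) - X i ∈ _
      rw [hev]
      exact Ideal.mem_span_singleton.mpr (dvd_mul_right _ _)
    exact Ideal.mem_span_singleton.mp (Ideal.Quotient.eq.mp (DFunLike.congr_fun h1 p))

lemma isReflectionAction_polyAction {W : Subgroup (V ≃ₗ[ℂ] V)}
    (hW : Subgroup.closure {g : V ≃ₗ[ℂ] V | g ∈ W ∧ IsReflection g} = W) :
    IsReflectionAction (polyAction b W) := by
  refine ⟨fun g => isLinearSubst_linSubst b _, ?_⟩
  set T := Subgroup.closure {g | IsReflectionSubst (polyAction b W g)}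
  have key : Subgroup.closure {g : V ≃ₗ[ℂ] V | g ∈ W ∧ IsReflection g} ≤ T.map W.subtype := by
    rw [Subgroup.closure_le]
    rintro g ⟨hgW, hg⟩
    refine ⟨⟨g, hgW⟩, ?_, rfl⟩
    rw [SetLike.mem_coe, ← T.inv_mem_iff]
    refine Subgroup.subset_closure ?_
    change IsReflectionSubst (linSubst b _)
    rw [inv_inv]
    exact isReflectionSubst_linSubst b hg
  rw [hW] at key
  refine eq_top_iff.mpr fun w _ => ?_
  obtain ⟨x, hx, hxw⟩ := key w.2
  rwa [← Subtype.ext hxw]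

lemma exists_isFixedPoly_norm (W : Subgroup (V ≃ₗ[ℂ] V)) [Fintype W] (q : MvPolynomial ι ℂ) :
    ∃ p, IsFixedPoly (polyAction b W) p ∧
      ∀ x, evalAt b x p = ∏ w : W, evalAt b (w.1 x) q := by
  have hev (x : V) : evalAt b x (∏ w : W, polyAction b W w⁻¹ q) =
      ∏ w : W, evalAt b (w.1 x) q := by
    rw [map_prod]
    exact Finset.prod_congr rfl fun w _ => by rw [evalAt_polyAction, inv_inv]
  refine ⟨∏ w : W, polyAction b W w⁻¹ q, ?_, hev⟩
  rw [isFixedPoly_polyAction_iff]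
  intro w hw v
  rw [hev, hev]
  exact Equiv.prod_comp (Equiv.mulRight (⟨w, hw⟩ : W)) fun g : W => evalAt b (g.1 v) q

/-- Invariants of a finite group separate orbits. -/
lemma exists_isFixedPoly_evalAt_ne {W : Subgroup (V ≃ₗ[ℂ] V)} [Fintype W] {x y : V}
    (h : ∀ w ∈ W, w x ≠ y) :
    ∃ p, IsFixedPoly (polyAction b W) p ∧ evalAt b x p ≠ evalAt b y p := by
  obtain ⟨l, hl⟩ := Module.exists_dual_forall_apply_ne_zero (K := ℂ)
    (fun w : W => w.1 x - y) (fun w => sub_ne_zero.mpr (h w w.2))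
  obtain ⟨p, hp, hpe⟩ := exists_isFixedPoly_norm b W (linForm b l - C (l y))
  have hq (z : V) : evalAt b z (linForm b l - C (l y)) = l (z - y) := by
    rw [map_sub, evalAt_linForm, map_sub]
    simp [evalAt]
  refine ⟨p, hp, ?_⟩
  have hy : evalAt b y p = 0 := by
    rw [hpe]
    refine Finset.prod_eq_zero (i := (1 : W)) (Finset.mem_univ _) ?_
    rw [hq]
    simp
  rw [hy, hpe]
  exact Finset.prod_ne_zero_iff.mpr fun w _ => by rw [hq]; exact hl w

/-- Invariants of a finite group separate points from the translates of a fixed space. -/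
lemma exists_isFixedPoly_vanishing {W : Subgroup (V ≃ₗ[ℂ] V)} [Fintype W] (σ : V →ₗ[ℂ] V) {x : V}
    (h : ∀ w ∈ W, σ (w x) ≠ w x) :
    ∃ p, IsFixedPoly (polyAction b W) p ∧ evalAt b x p ≠ 0 ∧
      ∀ y, σ y = y → evalAt b y p = 0 := by
  obtain ⟨l, hl⟩ := Module.exists_dual_forall_apply_ne_zero (K := ℂ)
    (fun w : W => σ (w.1 x) - w.1 x) (fun w => sub_ne_zero.mpr (h w w.2))
  obtain ⟨p, hp, hpe⟩ := exists_isFixedPoly_norm b W (linForm b (l ∘ₗ (σ - LinearMap.id)))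
  refine ⟨p, hp, ?_, fun y hy => ?_⟩
  · rw [hpe]
    exact Finset.prod_ne_zero_iff.mpr fun w _ => by rw [evalAt_linForm]; exact hl w
  · rw [hpe]
    refine Finset.prod_eq_zero (i := (1 : W)) (Finset.mem_univ _) ?_
    rw [evalAt_linForm]
    simp [hy]

/-- The Nullstellensatz in terms of points of `V`. -/
lemma mem_radical_of_evalAt_eq_zero {I : Ideal (MvPolynomial ι ℂ)} {p : MvPolynomial ι ℂ}
    (h : ∀ x, (∀ q ∈ I, evalAt b x q = 0) → evalAt b x p = 0) : p ∈ I.radical := by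
  rw [← vanishingIdeal_zeroLocus_eq_radical (K := ℂ), mem_vanishingIdeal_iff]
  intro x hx
  have key (q) : evalAt b (b.equivFun.symm x) q = aeval x q := by
    rw [evalAt, LinearEquiv.apply_symm_apply]
  rw [← key]
  exact h _ fun q hq => (key q).trans (hx q hq)

end Coordinates

open MvPolynomial in
/-- Among the fixed spaces of the elements of the coset `W τ` there is one whose `W`-translates
contain every point `x` such that `τ x` lies in the `W`-orbit of `x`. -/
theorem exists_fixed_translate (W : Subgroup (V ≃ₗ[ℂ] V)) [Finite W]
    (hW : Subgroup.closure {g : V ≃ₗ[ℂ] V | g ∈ W ∧ IsReflection g} = W)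
    (τ : V ≃ₗ[ℂ] V) (hτfin : IsOfFinOrder τ)
    (hnorm : ∀ g : V ≃ₗ[ℂ] V, g ∈ W ↔ τ * g * τ⁻¹ ∈ W) :
    ∃ w ∈ W, ∀ x, (∃ u ∈ W, τ x = u x) → ∃ u ∈ W, w (τ (u x)) = u x := by
  classical
  have : Fintype W := Fintype.ofFinite W
  obtain ⟨b⟩ : Nonempty (Basis (Fin (finrank ℂ V)) ℂ V) := ⟨Module.finBasis ℂ V⟩
  obtain ⟨θ, hθ⟩ : ∃ θ, θ = linSubst b (τ : V →ₗ[ℂ] V) := ⟨_, rfl⟩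
  have hθe (x : V) (p) : evalAt b x (θ p) = evalAt b (τ x) p := hθ ▸ evalAt_linSubst b _ x p
  have hθpow (m : ℕ) (x : V) (p) : evalAt b x ((θ ^ m) p) = evalAt b ((τ ^ m) x) p := by
    induction m generalizing x with
    | zero => simp
    | succ m ih => rw [pow_succ', AlgHom.mul_apply, hθe, ih, pow_succ]; rfl
  have hN : orderOf τ ≠ 0 := hτfin.orderOf_pos.ne'
  have hρ := isReflectionAction_polyAction b hW
  obtain ⟨t, d, ε, hf, hε⟩ := exists_isMinimalFundamental (ρ := polyAction b W)
    (Complex.isPrimitiveRoot_exp _ hN) hN (θ := θ) (hθ ▸ isLinearSubst_linSubst b _)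
    (by
      refine AlgHom.ext fun p => evalAt_ext b fun x => ?_
      rw [hθpow, pow_orderOf_eq_one]
      rfl)
    (by
      intro p hp
      rw [isFixedPoly_polyAction_iff] at hp ⊢
      intro w hw x
      rw [hθe, hθe, ← hp _ ((hnorm w).mp hw) (τ x)]
      simp [LinearEquiv.mul_apply])
  obtain ⟨f, hfdef⟩ : ∃ f : t → MvPolynomial (Fin (finrank ℂ V)) ℂ, f = fun k => k.1 :=
    ⟨_, rfl⟩
  rw [← hfdef] at hf
  replace hε (k : t) : θ (f k) = ε k • f k := hfdef ▸ hε k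
  have hevf (x : V) (Q : MvPolynomial t ℂ) :
      evalAt b x (aeval f Q) = aeval (fun k => evalAt b x (f k)) Q := by
    rw [← AlgHom.comp_apply]
    congr 1
    ext k
    simp
  have hετ (x : V) (k : t) : evalAt b (τ x) (f k) = ε k * evalAt b x (f k) := by
    rw [← hθe, hε, map_smul, smul_eq_mul]
  let Z : Set t := {k | ε k ≠ 1}
  let I := Ideal.span (f '' Z)
  have hprime := hf.isPrime_comap_span hρ Z
  have hI {x : V} (hx : ∃ u ∈ W, τ x = u x) {p} (hp : p ∈ I) : evalAt b x p = 0 := by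
    have hle : I ≤ RingHom.ker (evalAt b x) := by
      refine Ideal.span_le.mpr ?_
      rintro _ ⟨k, hk, rfl⟩
      obtain ⟨u, hu, hux⟩ := hx
      have h1 := hετ x k
      rw [hux, (isFixedPoly_polyAction_iff b).mp (hf.isFixedPoly k) u hu] at h1
      by_contra h0
      exact hk (mul_right_cancel₀ h0 (h1.symm.trans (one_mul _).symm))
    exact hle hp
  have hZ {x : V} (hx : ∀ p ∈ I, evalAt b x p = 0) : ∃ w ∈ W, w (τ x) = x := by
    by_contra! hc
    obtain ⟨p, hp, hpx⟩ := exists_isFixedPoly_evalAt_ne b hc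
    obtain ⟨Q, hQ⟩ := hf.mem_range_aeval hρ.isLinearSubst hp
    replace hQ : aeval f Q = p := hQ
    apply hpx
    rw [← hQ, hevf, hevf]
    congr 2
    ext k
    rw [hετ]
    by_cases hk : ε k = 1
    · rw [hk, one_mul]
    · rw [hx _ (Ideal.subset_span ⟨k, hk, rfl⟩), mul_zero]
  obtain ⟨w, hw⟩ : ∃ w : W, ∀ Q : MvPolynomial t ℂ,
      (∀ x, w.1 (τ x) = x → evalAt b x (aeval f Q) = 0) → aeval f Q ∈ I := by
    by_contra! hc
    choose Q hQ hQI using hc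
    have hrad : aeval f (∏ w, Q w) ∈ I.radical := by
      refine mem_radical_of_evalAt_eq_zero b fun x hx => ?_
      obtain ⟨u, hu, hux⟩ := hZ hx
      rw [map_prod, map_prod]
      have h0 := hQ ⟨u, hu⟩ x hux
      exact Finset.prod_eq_zero (i := (⟨u, hu⟩ : W)) (Finset.mem_univ _) h0
    obtain ⟨m, hm⟩ := hrad
    rw [← map_pow] at hm
    obtain ⟨w, -, hw⟩ := hprime.prod_mem_iff.mp (hprime.mem_of_pow_mem m hm)
    exact hQI w hw
  refine ⟨w, w.2, fun x hx => ?_⟩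
  by_contra! hc
  obtain ⟨p, hp, hpx, hp0⟩ := exists_isFixedPoly_vanishing b
    ((w.1 : V →ₗ[ℂ] V) ∘ₗ (τ : V →ₗ[ℂ] V)) hc
  obtain ⟨Q, hQ⟩ := hf.mem_range_aeval hρ.isLinearSubst hp
  replace hQ : aeval f Q = p := hQ
  exact hpx (hI hx (hQ ▸ hw Q fun y hy => by rw [hQ]; exact hp0 y hy))

/-- Springer's theorem for a regular `τ`: every point `x` such that `τ x` lies in the `W`-orbit
of `x` is `W`-conjugate to a fixed point of `τ`. -/
theorem exists_mem_apply_eq_self (W : Subgroup (V ≃ₗ[ℂ] V)) [Finite W]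
    (hW : Subgroup.closure {g : V ≃ₗ[ℂ] V | g ∈ W ∧ IsReflection g} = W)
    (τ : V ≃ₗ[ℂ] V) (hτfin : IsOfFinOrder τ)
    (hnorm : ∀ g : V ≃ₗ[ℂ] V, g ∈ W ↔ τ * g * τ⁻¹ ∈ W)
    (hreg : ∃ v ∈ VReg W, τ v = v) {x : V} (hx : ∃ w ∈ W, τ x = w x) :
    ∃ u ∈ W, τ (u x) = u x := by
  obtain ⟨w, hw, key⟩ := exists_fixed_translate W hW τ hτfin hnorm
  obtain ⟨v, hv, hτv⟩ := hreg
  obtain ⟨u, hu, huv⟩ := key v ⟨1, W.one_mem, by simpa using hτv⟩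
  obtain ⟨u', hu', hux⟩ := key x hx
  have h1 : u⁻¹ * (w * (τ * u * τ⁻¹)) = 1 := by
    refine hv _ (W.mul_mem (W.inv_mem hu) (W.mul_mem hw ((hnorm u).mp hu))) ?_
    have h2 : τ⁻¹ v = v := by
      conv_lhs => rw [← hτv]
      exact τ.symm_apply_apply v
    simp only [LinearEquiv.mul_apply, h2, huv]
    exact u.symm_apply_apply v
  have h3 : u⁻¹ * w * τ = τ * u⁻¹ := by
    have h4 : u⁻¹ * w * τ * (u * τ⁻¹) = 1 := by rw [← h1]; group
    rw [mul_eq_one_iff_eq_inv.mp h4]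
    group
  refine ⟨u⁻¹ * u', W.mul_mem (W.inv_mem hu) hu', ?_⟩
  have h5 := DFunLike.congr_fun h3 (u' x)
  simp only [LinearEquiv.mul_apply, hux] at h5 ⊢
  exact h5.symm

lemma pAct_mul (g h : V ≃ₗ[ℂ] V) (p : V × Module.Dual ℂ V) :
    pAct (g * h) p = pAct g (pAct h p) := rfl

lemma pAct_one (p : V × Module.Dual ℂ V) : pAct 1 p = p := rfl

lemma pAct_inv_pAct (g : V ≃ₗ[ℂ] V) (p : V × Module.Dual ℂ V) : pAct g⁻¹ (pAct g p) = p := by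
  rw [← pAct_mul, inv_mul_cancel, pAct_one]

lemma pAct_eq_iff {g : V ≃ₗ[ℂ] V} {p q : V × Module.Dual ℂ V} :
    pAct g p = q ↔ p = pAct g⁻¹ q := by
  constructor
  · rintro rfl
    rw [pAct_inv_pAct]
  · rintro rfl
    rw [← pAct_mul, mul_inv_cancel, pAct_one]

lemma apply_mem_VReg {W : Subgroup (V ≃ₗ[ℂ] V)} {v : V} (hv : v ∈ VReg W) {u : V ≃ₗ[ℂ] V}
    (hu : u ∈ W) : u v ∈ VReg W := fun w hw h => by
  have h1 : u⁻¹ * w * u = 1 := by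
    refine hv _ (W.mul_mem (W.mul_mem (W.inv_mem hu) hw) hu) ?_
    rw [LinearEquiv.mul_apply, LinearEquiv.mul_apply, h]
    exact u.symm_apply_apply v
  have h2 : w = u * (u⁻¹ * w * u) * u⁻¹ := by group
  rw [h2, h1]
  group

lemma eq_of_pAct_eq_pAct {W : Subgroup (V ≃ₗ[ℂ] V)} {p : V × Module.Dual ℂ V}
    (hp : p.1 ∈ VReg W) {g h : V ≃ₗ[ℂ] V} (hg : g ∈ W) (hh : h ∈ W)
    (hgh : pAct g p = pAct h p) : g = h := by
  have h1 : pAct (h⁻¹ * g) p = p := by rw [pAct_mul, hgh, pAct_inv_pAct]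
  exact (inv_mul_eq_one.mp (hp _ (W.mul_mem (W.inv_mem hh) hg) (congrArg Prod.fst h1))).symm

lemma orbit_eq_of_mem {W : Subgroup (V ≃ₗ[ℂ] V)} {p q : V × Module.Dual ℂ V} {u : V ≃ₗ[ℂ] V}
    (hu : u ∈ W) (hq : pAct u p = q) :
    {r | ∃ w ∈ W, pAct w q = r} = {r | ∃ w ∈ W, pAct w p = r} := by
  subst hq
  ext r
  constructor
  · rintro ⟨w, hw, rfl⟩
    exact ⟨w * u, W.mul_mem hw hu, rfl⟩
  · rintro ⟨w, hw, rfl⟩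
    refine ⟨w * u⁻¹, W.mul_mem hw (W.inv_mem hu), ?_⟩
    rw [pAct_mul, pAct_inv_pAct]

lemma pAct_pAct_of_fixed {τ : V ≃ₗ[ℂ] V} {p : V × Module.Dual ℂ V} (hp : pAct τ p = p)
    (w : V ≃ₗ[ℂ] V) : pAct τ (pAct w p) = pAct (τ * w * τ⁻¹) p := by
  rw [pAct_mul, pAct_mul, ← pAct_eq_iff.mp hp]

lemma image_orbit_of_fixed {W : Subgroup (V ≃ₗ[ℂ] V)} {τ : V ≃ₗ[ℂ] V}
    (hnorm : ∀ g : V ≃ₗ[ℂ] V, g ∈ W ↔ τ * g * τ⁻¹ ∈ W) {p : V × Module.Dual ℂ V}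
    (hp : pAct τ p = p) :
    (fun q => pAct τ q) '' {q | ∃ w ∈ W, pAct w p = q} = {q | ∃ w ∈ W, pAct w p = q} := by
  ext q
  constructor
  · rintro ⟨_, ⟨w, hw, rfl⟩, rfl⟩
    exact ⟨_, (hnorm w).mp hw, (pAct_pAct_of_fixed hp w).symm⟩
  · rintro ⟨w, hw, rfl⟩
    have h : τ * (τ⁻¹ * w * τ) * τ⁻¹ = w := by group
    refine ⟨pAct (τ⁻¹ * w * τ) p, ⟨_, (hnorm _).mpr (h.symm ▸ hw), rfl⟩, ?_⟩
    change pAct τ _ = _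
    rw [pAct_pAct_of_fixed hp, h]

/-- Two fixed pairs of `τ` over regular points that are conjugate under `W` are conjugate under
the centralizer of `τ`. -/
lemma commute_of_pAct_eq {W : Subgroup (V ≃ₗ[ℂ] V)} {τ : V ≃ₗ[ℂ] V}
    (hnorm : ∀ g : V ≃ₗ[ℂ] V, g ∈ W ↔ τ * g * τ⁻¹ ∈ W) {p q : V × Module.Dual ℂ V}
    (hpreg : p.1 ∈ VReg W) (hp : pAct τ p = p) (hq : pAct τ q = q) {w : V ≃ₗ[ℂ] V} (hw : w ∈ W)
    (hwq : pAct w p = q) : τ * w = w * τ := by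
  have h := eq_of_pAct_eq_pAct hpreg ((hnorm w).mp hw) hw
    (by rw [← pAct_pAct_of_fixed hp, hwq, hq])
  exact mul_inv_eq_iff_eq_mul.mp h

/-- If `τ` is a regular element normalizing the complex reflection group `W`, then sending
the `W^τ`-orbit of a pair `(v, v*) ∈ V_reg^τ × (V*)^τ` to its `W`-orbit is a bijection from
the set of `W^τ`-orbits on `V_reg^τ × (V*)^τ` onto the set of `τ`-stable `W`-orbits on
`V_reg × V*`. -/
theorem stmt2 (W : Subgroup (V ≃ₗ[ℂ] V)) [Finite W]
    (hW : Subgroup.closure {g : V ≃ₗ[ℂ] V | g ∈ W ∧ IsReflection g} = W)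
    (τ : V ≃ₗ[ℂ] V) (hτfin : IsOfFinOrder τ)
    (hnorm : ∀ g : V ≃ₗ[ℂ] V, g ∈ W ↔ τ * g * τ⁻¹ ∈ W)
    (hreg : ∃ v ∈ VReg W, τ v = v) :
    ∃ f : {S : Set (V × Module.Dual ℂ V) //
            ∃ p : V × Module.Dual ℂ V, p.1 ∈ VReg W ∧ pAct τ p = p ∧
              S = {q | ∃ w ∈ W, τ * w = w * τ ∧ pAct w p = q}} →
          {S : Set (V × Module.Dual ℂ V) //
            (∃ p : V × Module.Dual ℂ V, p.1 ∈ VReg W ∧ S = {q | ∃ w ∈ W, pAct w p = q}) ∧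
              (fun q => pAct τ q) '' S = S},
      Function.Bijective f ∧
      ∀ (p : V × Module.Dual ℂ V) (hp : p.1 ∈ VReg W) (hτp : pAct τ p = p),
        (f ⟨{q | ∃ w ∈ W, τ * w = w * τ ∧ pAct w p = q}, p, hp, hτp, rfl⟩ : Set (V × Module.Dual ℂ V)) =
          {q | ∃ w ∈ W, pAct w p = q} := by
  let orb (p : V × Module.Dual ℂ V) : Set (V × Module.Dual ℂ V) := {q | ∃ w ∈ W, pAct w p = q}
  let sat (S : Set (V × Module.Dual ℂ V)) : Set (V × Module.Dual ℂ V) :=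
    {q | ∃ r ∈ S, ∃ w ∈ W, pAct w r = q}
  have hsat (p) : sat {q | ∃ w ∈ W, τ * w = w * τ ∧ pAct w p = q} = orb p := by
    ext q
    constructor
    · rintro ⟨_, ⟨w, hw, -, rfl⟩, u, hu, rfl⟩
      exact ⟨u * w, W.mul_mem hu hw, rfl⟩
    · rintro ⟨w, hw, rfl⟩
      exact ⟨p, ⟨1, W.one_mem, by simp, rfl⟩, w, hw, rfl⟩
  refine ⟨fun S => ⟨sat S.1, ?_⟩, ⟨?_, ?_⟩, fun p hp hτp => hsat p⟩
  · obtain ⟨_, p, hp, hτp, rfl⟩ := S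
    rw [hsat p]
    exact ⟨⟨p, hp, rfl⟩, image_orbit_of_fixed hnorm hτp⟩
  · rintro ⟨_, p, hp, hτp, rfl⟩ ⟨_, q, hq, hτq, rfl⟩ h
    replace h : orb p = orb q := by
      rw [← hsat p, ← hsat q]
      exact congrArg Subtype.val h
    have hmem : q ∈ orb p := h ▸ ⟨1, W.one_mem, rfl⟩
    obtain ⟨w, hw, rfl⟩ := hmem
    have hc := commute_of_pAct_eq hnorm hp hτp hτq hw rfl
    refine Subtype.ext ?_
    ext r
    constructor
    · rintro ⟨u, hu, huτ, rfl⟩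
      refine ⟨u * w⁻¹, W.mul_mem hu (W.inv_mem hw), ?_, ?_⟩
      · exact (Commute.mul_right huτ (Commute.inv_right hc)).eq
      · rw [pAct_mul, pAct_inv_pAct]
    · rintro ⟨u, hu, huτ, rfl⟩
      exact ⟨u * w, W.mul_mem hu hw, (Commute.mul_right huτ hc).eq, rfl⟩
  · rintro ⟨_, ⟨p, hp, rfl⟩, hS⟩
    have hτp : pAct τ p ∈ orb p := hS.subset ⟨p, ⟨1, W.one_mem, rfl⟩, rfl⟩
    obtain ⟨w, hw, hwp⟩ := hτp
    obtain ⟨u, hu, hup⟩ := exists_mem_apply_eq_self W hW τ hτfin hnorm hreg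
      ⟨w, hw, (congrArg Prod.fst hwp).symm⟩
    have hreg' : (pAct u p).1 ∈ VReg W := apply_mem_VReg hp hu
    have h1 : pAct τ (pAct u p) = pAct (τ * u * τ⁻¹ * w) p := by
      rw [pAct_mul, hwp, ← pAct_mul, ← pAct_mul]
      congr 1
      group
    have h2 : u⁻¹ * (τ * u * τ⁻¹ * w) = 1 := by
      refine hp _ (W.mul_mem (W.inv_mem hu) (W.mul_mem ((hnorm u).mp hu) hw)) ?_
      have h3 : (τ * u * τ⁻¹ * w) p.1 = u p.1 := (congrArg Prod.fst h1).symm.trans hup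
      rw [LinearEquiv.mul_apply, h3]
      exact u.symm_apply_apply _
    have hfix : pAct τ (pAct u p) = pAct u p := by rw [h1, ← inv_mul_eq_one.mp h2]
    refine ⟨⟨_, pAct u p, hreg', hfix, rfl⟩, Subtype.ext ?_⟩
    exact (hsat _).trans (orbit_eq_of_mem hu rfl)
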